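/- Let W be a suitable basis of A at {β₁,…,β_I}, and let f_w ∈ C[x] and N_w ∈ C[x]^{r×r} be such that W = (1/f_w)·N_w·SW and the gcd of f_w together with all entries of N_w equals 1. Then f_w is shift-free, every root of f_w in C̄ lies in {β₁,…,β_I}, and N_w is an invertible matrix over C(x). -/

import Mathlib

set_option maxHeartbeats 1000000
set_option synthInstance.maxHeartbeats 200000

open Polynomial Filter

noncomputable section

namespace PRec

variable (C : Type*) [Field C] [CharZero C]

/-- The algebraic closure of the coefficient field. -/
abbrev Cbar := AlgebraicClosure C

/-- The field of formal Laurent series over the algebraic closure. -/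
abbrev LS := LaurentSeries (Cbar C)

/-- The Laurent-series variable `q`. -/
def qv : LS C := HahnSeries.single 1 1

open Classical in
/-- The valuation `ν_q`, with `ν_q 0 = ⊤`, valued in the extended reals. -/
def nuq (a : LS C) : EReal := if a = 0 then ⊤ else (((a.order : ℤ) : ℝ) : EReal)

/-- Evaluation of a rational function at the point `α + m + q`. -/
def evalAt (α : Cbar C) (m : ℤ) (p : RatFunc C) : LS C :=
  RatFunc.eval ((algebraMap (Cbar C) (LS C)).comp (algebraMap C (Cbar C)))
    (algebraMap (Cbar C) (LS C) α + (m : LS C) + qv C) p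

/-- Shorthand for the canonical map `C[x] → C(x)`. -/
abbrev toRat : Polynomial C →+* RatFunc C := algebraMap (Polynomial C) (RatFunc C)

variable (ℓ : ℕ → Polynomial C) (r : ℕ)

/-- The solution space `Sol_α(L)` of `L = ℓ₀ + ℓ₁ S + ⋯ + ℓ_r S^r` at `α`,
indexed so that `b n` stands for the value of the solution at `α + n`. -/
def SolSet (α : Cbar C) : Set (ℤ → LS C) :=
  {b | ∀ n : ℤ, ∑ i ∈ Finset.range (r + 1),
      evalAt C α n (toRat C (ℓ i)) * b (n + i) = 0}

/-- The action of an element `f = f₀ + f₁ S + ⋯ + f_{r-1} S^{r-1}` of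
`A = C(x)[S]/⟨L⟩` (represented by its coefficient vector) on a sequence. -/
def elemApply (α : Cbar C) (f : Fin r → RatFunc C) (b : ℤ → LS C) : ℤ → LS C :=
  fun n => ∑ i : Fin r, evalAt C α n (f i) * b (n + (i : ℤ))

/-- Truncated subtraction on extended reals with the convention `⊤ - ⊤ = ⊤`. -/
def esub (a b : EReal) : EReal := if b = ⊤ then ⊤ else a - b

/-- The value function `val_α` on `A`. -/
def valAt (α : Cbar C) (f : Fin r → RatFunc C) : EReal :=
  ⨅ b ∈ SolSet C ℓ r α,
    esub (nuq C (elemApply C r α f b 0))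
      (Filter.liminf (fun n : ℕ => nuq C (b (-(n : ℤ)))) Filter.atTop)

/-- `f ∈ A` is (locally) integral at `α`. -/
def IntegralAt (α : Cbar C) (f : Fin r → RatFunc C) : Prop :=
  0 ≤ valAt C ℓ r α f

/-- Membership in the local subring `C(x)_α` of rational functions having no pole at `α`. -/
def InLocalRing (α : Cbar C) (f : RatFunc C) : Prop :=
  ∃ p q : Polynomial C, (Polynomial.aeval α) q ≠ 0 ∧ f = toRat C p / toRat C q

/-- `W` is a `C(x)`-vector space basis of `A` (represented on coefficient vectors). -/
def IsVSBasis (W : Fin r → (Fin r → RatFunc C)) : Prop :=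
  LinearIndependent (RatFunc C) W ∧
    Submodule.span (RatFunc C) (Set.range W) = (⊤ : Submodule (RatFunc C) (Fin r → RatFunc C))

/-- The `C(x)_α`-span of a tuple of elements of `A`. -/
def localSpan (α : Cbar C) (W : Fin r → (Fin r → RatFunc C)) :
    Set (Fin r → RatFunc C) :=
  {f | ∃ c : Fin r → RatFunc C, (∀ i, InLocalRing C α (c i)) ∧ f = ∑ i, c i • W i}

/-- `W` is a local integral basis of `A` at `α`. -/
def IsLocalIntegralBasis (α : Cbar C) (W : Fin r → (Fin r → RatFunc C)) : Prop :=
  IsVSBasis C r W ∧ (∀ i, IntegralAt C ℓ r α (W i)) ∧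
    ∀ f : Fin r → RatFunc C, IntegralAt C ℓ r α f → f ∈ localSpan C r α W

/-- The standard basis `1, S, …, S^{r-1}` of `A`. -/
def stdBasis : Fin r → (Fin r → RatFunc C) :=
  fun i j => if j = i then 1 else 0

/-- The shift automorphism `p(x) ↦ p(x+c)` of the polynomial ring. -/
def polyShiftEquiv (c : C) : Polynomial C ≃+* Polynomial C where
  toFun p := p.comp (X + Polynomial.C c)
  invFun p := p.comp (X - Polynomial.C c)
  left_inv p := by
    show (p.comp (X + Polynomial.C c)).comp (X - Polynomial.C c) = p
    rw [Polynomial.comp_assoc]; simp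
  right_inv p := by
    show (p.comp (X - Polynomial.C c)).comp (X + Polynomial.C c) = p
    rw [Polynomial.comp_assoc]; simp
  map_add' p q := by simp [Polynomial.add_comp]
  map_mul' p q := by simp [Polynomial.mul_comp]

/-- The shift `σ^k`, `p(x) ↦ p(x+k)`, on polynomials, for `k : ℤ`. -/
def polyShift (k : ℤ) (p : Polynomial C) : Polynomial C := polyShiftEquiv C (k : C) p

/-- `σ` on polynomials. -/
def polyσ : Polynomial C ≃+* Polynomial C := polyShiftEquiv C 1

/-- The shift automorphism `σ : f(x) ↦ f(x+1)` of the rational function field. -/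
def ratσ : RatFunc C →+* RatFunc C :=
  RatFunc.mapRingHom (polyσ C : Polynomial C →+* Polynomial C)
    (by
      intro p hp
      simp only [Submonoid.mem_comap]
      refine mem_nonZeroDivisors_iff_ne_zero.mpr ?_
      have hp0 : p ≠ 0 := mem_nonZeroDivisors_iff_ne_zero.mp hp
      simpa using (map_ne_zero_iff _ (polyσ C).injective).mpr hp0)

variable [NeZero r]

/-- The index `r - 1` as an element of `Fin r`. -/
def lastIdx : Fin r := ⟨r - 1, Nat.sub_lt (Nat.pos_of_ne_zero (NeZero.ne r)) one_pos⟩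

/-- The action of `S` on `A = C(x)[S]/⟨L⟩`, on coefficient vectors with respect to the
basis `1, S, …, S^{r-1}`, using `S^r = -(ℓ₀/ℓ_r) - ⋯ - (ℓ_{r-1}/ℓ_r) S^{r-1}`. -/
def Smap (f : Fin r → RatFunc C) : Fin r → RatFunc C :=
  fun j =>
    (if (j : ℕ) = 0 then 0 else
      ratσ C (f ⟨(j : ℕ) - 1, lt_of_le_of_lt (Nat.sub_le _ _) j.isLt⟩))
      - ratσ C (f (lastIdx r)) * (toRat C (ℓ j) / toRat C (ℓ r))

/-- The difference operator `Δ = S - 1` on `A`. -/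
def Dmap (f : Fin r → RatFunc C) : Fin r → RatFunc C :=
  Smap C ℓ r f - f

/-- `f ∈ A` is summable. -/
def IsSummable (f : Fin r → RatFunc C) : Prop :=
  ∃ g : Fin r → RatFunc C, f = Dmap C ℓ r g

/-- `disp_α(p) ≥ k`: `p` has two roots in `α + ℤ` at distance `k`. -/
def DispGe (α : Cbar C) (p : Polynomial (Cbar C)) (k : ℕ) : Prop :=
  ∃ m : ℤ, Polynomial.eval (α + (m : Cbar C)) p = 0 ∧
    Polynomial.eval (α + (m : Cbar C) + (k : Cbar C)) p = 0

/-- The dispersion `disp_α(p)` as an extended natural number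
(`0` by convention for the empty set, which is excluded by the hypotheses below). -/
def dispVal (α : Cbar C) (p : Polynomial (Cbar C)) : ℕ∞ :=
  sSup ((fun k : ℕ => (k : ℕ∞)) '' {k : ℕ | DispGe C α p k})

/-- A polynomial is shift-free if it is coprime to each of its nontrivial shifts. -/
def ShiftFree {K : Type*} [Field K] [CharZero K] (p : Polynomial K) : Prop :=
  ∀ k : ℤ, k ≠ 0 → IsCoprime p (p.comp (X + Polynomial.C (k : K)))


/-- The data of the orbits `α_i + ℤ` of the roots of `ℓ₀ℓ_r`, with the minimal root
`minR i = α_{i,1}`, the maximal root `maxR i = α_{i,J_i}`, and the chosen bounds `β i`. -/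
structure SuitableData (I : ℕ) where
  β : Fin I → Cbar C
  minR : Fin I → Cbar C
  maxR : Fin I → Cbar C
  minR_root : ∀ i, (Polynomial.aeval (minR i)) (ℓ 0 * ℓ r) = 0
  maxR_root : ∀ i, (Polynomial.aeval (maxR i)) (ℓ 0 * ℓ r) = 0
  minR_le_maxR : ∀ i, ∃ m : ℕ, maxR i = minR i + (m : Cbar C)
  maxR_le_β : ∀ i, ∃ m : ℕ, β i = maxR i + (m : Cbar C)
  roots_between : ∀ i (m : ℤ), (Polynomial.aeval (minR i + (m : Cbar C))) (ℓ 0 * ℓ r) = 0 →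
    0 ≤ m ∧ ∃ k : ℕ, maxR i = minR i + (m : Cbar C) + (k : Cbar C)
  orbits_distinct : ∀ i i', i ≠ i' → ∀ m : ℤ, β i ≠ β i' + (m : Cbar C)
  orbits_cover : ∀ ξ : Cbar C, (Polynomial.aeval ξ) (ℓ 0 * ℓ r) = 0 →
    ∃ i, ∃ m : ℤ, ξ = β i + (m : Cbar C)
  conj_compat : ∀ (φ : Cbar C ≃ₐ[C] Cbar C) (i i' : Fin I), φ (maxR i) = maxR i' →
    β i - maxR i = β i' - maxR i'

/-- Membership in `Z = ⋃ᵢ {γ ∈ αᵢ + ℤ : α_{i,1} < γ ≤ βᵢ}`. -/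
def memZ {I : ℕ} (D : SuitableData C ℓ r I) (γ : Cbar C) : Prop :=
  ∃ i, (∃ m : ℕ, γ + (m : Cbar C) = D.β i) ∧ (∃ k : ℕ, 1 ≤ k ∧ γ = D.minR i + (k : Cbar C))

/-- `W` is a suitable basis of `A` at `{β₁, …, β_I}`. -/
def IsSuitableBasis {I : ℕ} (D : SuitableData C ℓ r I) (W : Fin r → (Fin r → RatFunc C)) :
    Prop :=
  IsVSBasis C r W ∧
    (∀ γ : Cbar C, memZ C ℓ r D γ → IsLocalIntegralBasis C ℓ r γ W) ∧
    (∀ γ : Cbar C, ¬ memZ C ℓ r D γ → localSpan C r γ W = localSpan C r γ (stdBasis C r))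

set_option linter.unusedSectionVars false

/-! ### Evaluation at `α + m + q` -/

/-- The Taylor expansion of a polynomial at `α + m`, as a power series in `q`. -/
def taylorPS (α : Cbar C) (m : ℤ) : Polynomial C →+* PowerSeries (Cbar C) :=
  (Polynomial.coeToPowerSeries.ringHom).comp
    ((Polynomial.compRingHom (X + Polynomial.C (α + (m : Cbar C)))).comp
      (Polynomial.mapRingHom (algebraMap C (Cbar C))))

theorem taylorPS_apply (α : Cbar C) (m : ℤ) (p : Polynomial C) :
    taylorPS C α m p =
      (((p.map (algebraMap C (Cbar C))).comp (X + Polynomial.C (α + (m : Cbar C))) :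
        Polynomial (Cbar C)) : PowerSeries (Cbar C)) := rfl

theorem taylorPS_injective (α : Cbar C) (m : ℤ) : Function.Injective (taylorPS C α m) := by
  intro p p' h
  rw [taylorPS_apply, taylorPS_apply, Polynomial.coe_inj] at h
  have h2 := congrArg (fun t => t.comp (X - Polynomial.C (α + (m : Cbar C)))) h
  simp only [Polynomial.comp_assoc, Polynomial.add_comp, Polynomial.X_comp, Polynomial.C_comp,
    sub_add_cancel, Polynomial.comp_X] at h2
  exact Polynomial.map_injective _ (algebraMap C (Cbar C)).injective h2

theorem constantCoeff_taylorPS (α : Cbar C) (m : ℤ) (p : Polynomial C) :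
    PowerSeries.constantCoeff (taylorPS C α m p) = Polynomial.aeval (α + (m : Cbar C)) p := by
  rw [taylorPS_apply, Polynomial.constantCoeff_coe, Polynomial.coeff_zero_eq_eval_zero,
    Polynomial.eval_comp, Polynomial.aeval_def, Polynomial.eval_map]
  simp

theorem eval₂_eq_taylorPS (α : Cbar C) (m : ℤ) (p : Polynomial C) :
    p.eval₂ ((algebraMap (Cbar C) (LS C)).comp (algebraMap C (Cbar C)))
      (algebraMap (Cbar C) (LS C) α + (m : LS C) + qv C) =
      HahnSeries.ofPowerSeries ℤ (Cbar C) (taylorPS C α m p) := by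
  have h : Polynomial.eval₂RingHom ((algebraMap (Cbar C) (LS C)).comp (algebraMap C (Cbar C)))
      (algebraMap (Cbar C) (LS C) α + (m : LS C) + qv C) =
      (HahnSeries.ofPowerSeries ℤ (Cbar C)).comp (taylorPS C α m) := by
    have hC : ∀ a : Cbar C, algebraMap (Cbar C) (LS C) a =
        HahnSeries.ofPowerSeries ℤ (Cbar C) (PowerSeries.C a) := by
      intro a
      simp [HahnSeries.algebraMap_apply']
    apply Polynomial.ringHom_ext
    · intro a
      simp [taylorPS_apply, hC]
    · have hm : HahnSeries.ofPowerSeries ℤ (Cbar C)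
          ((m : Polynomial (Cbar C)) : PowerSeries (Cbar C)) = (m : LS C) := by
        rw [← Polynomial.coeToPowerSeries.ringHom_apply, map_intCast, map_intCast]
      simp [taylorPS_apply, hC, qv, hm]
      ring
  exact congrArg (fun t => t p) h

theorem eval₂_ne_zero (α : Cbar C) (m : ℤ) {p : Polynomial C} (hp : p ≠ 0) :
    p.eval₂ ((algebraMap (Cbar C) (LS C)).comp (algebraMap C (Cbar C)))
      (algebraMap (Cbar C) (LS C) α + (m : LS C) + qv C) ≠ 0 := by
  rw [eval₂_eq_taylorPS]
  intro h
  exact hp (taylorPS_injective C α m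
    (HahnSeries.ofPowerSeries_injective (h.trans (map_zero _).symm) |>.trans (map_zero _).symm))

/-- Evaluation at `α + m + q` as a ring homomorphism. -/
def evalHom (α : Cbar C) (m : ℤ) : RatFunc C →+* LS C where
  toFun := evalAt C α m
  map_one' := RatFunc.eval_one _ _
  map_zero' := RatFunc.eval_zero _ _
  map_mul' p p' := RatFunc.eval_mul
    _ _ (eval₂_ne_zero C α m p.denom_ne_zero) (eval₂_ne_zero C α m p'.denom_ne_zero)
  map_add' p p' := RatFunc.eval_add
    _ _ (eval₂_ne_zero C α m p.denom_ne_zero) (eval₂_ne_zero C α m p'.denom_ne_zero)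

theorem evalAt_eq_evalHom (α : Cbar C) (m : ℤ) (p : RatFunc C) :
    evalAt C α m p = evalHom C α m p := rfl

theorem evalHom_toRat (α : Cbar C) (m : ℤ) (p : Polynomial C) :
    evalHom C α m (toRat C p) = HahnSeries.ofPowerSeries ℤ (Cbar C) (taylorPS C α m p) := by
  rw [← evalAt_eq_evalHom, ← eval₂_eq_taylorPS, evalAt, RatFunc.eval_algebraMap,
    Algebra.algebraMap_self, RingHom.id_apply]

theorem evalHom_toRat_ne_zero (α : Cbar C) (m : ℤ) {p : Polynomial C} (hp : p ≠ 0) :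
    evalHom C α m (toRat C p) ≠ 0 :=
  (_root_.map_ne_zero _).mpr (RatFunc.algebraMap_ne_zero hp)

theorem evalAt_add_one (α : Cbar C) (m : ℤ) (p : RatFunc C) :
    evalAt C (α + 1) m p = evalAt C α (m + 1) p := by
  unfold evalAt
  congr 1
  simp only [map_add, map_one]
  push_cast
  ring

theorem ratσ_toRat (p : Polynomial C) : ratσ C (toRat C p) = toRat C (polyσ C p) := by
  have h := RatFunc.map_apply_div_ne_zero (polyσ C : Polynomial C →+* Polynomial C)
    (nonZeroDivisors_le_comap_nonZeroDivisors_of_injective _ (polyσ C).injective)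
    p 1 one_ne_zero
  simp only [map_one, div_one] at h
  exact h

theorem ratσ_div (p p' : Polynomial C) :
    ratσ C (toRat C p / toRat C p') = toRat C (polyσ C p) / toRat C (polyσ C p') := by
  rw [map_div₀, ratσ_toRat, ratσ_toRat]

theorem taylorPS_polyσ (α : Cbar C) (m : ℤ) (p : Polynomial C) :
    taylorPS C α m (polyσ C p) = taylorPS C α (m + 1) p := by
  rw [taylorPS_apply, taylorPS_apply]
  have h : polyσ C p = p.comp (X + Polynomial.C 1) := rfl
  rw [h, Polynomial.map_comp, Polynomial.comp_assoc]
  congr 2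
  simp
  ring

theorem evalHom_ratσ (α : Cbar C) (m : ℤ) (p : RatFunc C) :
    evalHom C α m (ratσ C p) = evalHom C α (m + 1) p := by
  induction p using RatFunc.induction_on with
  | f p p' hp' =>
    rw [ratσ_div, map_div₀, map_div₀, evalHom_toRat, evalHom_toRat, evalHom_toRat, evalHom_toRat,
      taylorPS_polyσ, taylorPS_polyσ]

theorem ratσ_surjective : Function.Surjective (ratσ C) := by
  intro p
  induction p using RatFunc.induction_on with
  | f p p' hp' =>
    exact ⟨toRat C ((polyσ C).symm p) / toRat C ((polyσ C).symm p'), by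
      rw [ratσ_div, RingEquiv.apply_symm_apply, RingEquiv.apply_symm_apply]⟩

theorem aeval_polyσ (α : Cbar C) (p : Polynomial C) :
    Polynomial.aeval α (polyσ C p) = Polynomial.aeval (α + 1) p := by
  change Polynomial.aeval α (p.comp (X + Polynomial.C 1)) = _
  simp [Polynomial.aeval_comp]

/-! ### Local rings and local spans -/

/-- The local ring `C(x)_α` as a subring of `C(x)`. -/
def localSubring (α : Cbar C) : Subring (RatFunc C) where
  carrier := {f | InLocalRing C α f}
  one_mem' := ⟨1, 1, by simp, by simp⟩
  zero_mem' := ⟨0, 1, by simp, by simp⟩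
  neg_mem' := by
    rintro _ ⟨p, q, hq, rfl⟩
    exact ⟨-p, q, hq, by rw [map_neg, neg_div]⟩
  mul_mem' := by
    rintro _ _ ⟨p, q, hq, rfl⟩ ⟨p', q', hq', rfl⟩
    exact ⟨p * p', q * q', by simpa using ⟨hq, hq'⟩, by rw [map_mul, map_mul, div_mul_div_comm]⟩
  add_mem' := by
    rintro _ _ ⟨p, q, hq, rfl⟩ ⟨p', q', hq', rfl⟩
    have h : ∀ {t : Polynomial C}, Polynomial.aeval α t ≠ 0 → toRat C t ≠ 0 := by
      intro t ht
      apply RatFunc.algebraMap_ne_zero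
      rintro rfl
      simp at ht
    refine ⟨p * q' + q * p', q * q', by simpa using ⟨hq, hq'⟩, ?_⟩
    rw [div_add_div _ _ (h hq) (h hq')]
    simp only [map_add, map_mul]

theorem inLocalRing_toRat (α : Cbar C) (p : Polynomial C) : InLocalRing C α (toRat C p) :=
  ⟨p, 1, by simp, by simp⟩

theorem InLocalRing.ratσ {α : Cbar C} {f : RatFunc C} (hf : InLocalRing C (α + 1) f) :
    InLocalRing C α (PRec.ratσ C f) := by
  obtain ⟨p, q, hq, rfl⟩ := hf
  exact ⟨polyσ C p, polyσ C q, by rwa [aeval_polyσ], ratσ_div C p q⟩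

theorem aeval_eq_zero_of_inLocalRing_div {α : Cbar C} {p f : Polynomial C} (hf : f ≠ 0)
    (h : InLocalRing C α (toRat C p / toRat C f)) (hα : Polynomial.aeval α f = 0) :
    Polynomial.aeval α p = 0 := by
  obtain ⟨u, v, hv, h⟩ := h
  have hv0 : v ≠ 0 := by
    rintro rfl
    simp at hv
  rw [div_eq_div_iff (RatFunc.algebraMap_ne_zero hf) (RatFunc.algebraMap_ne_zero hv0),
    ← map_mul, ← map_mul] at h
  have h2 := congrArg (Polynomial.aeval α) (RatFunc.algebraMap_injective C h)
  rw [map_mul, map_mul, hα, mul_zero] at h2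
  exact (mul_eq_zero.mp h2).resolve_right hv

theorem mem_localSpan_self (α : Cbar C) (V : Fin r → (Fin r → RatFunc C)) (i : Fin r) :
    V i ∈ localSpan C r α V := by
  refine ⟨fun j => if j = i then 1 else 0, fun j => ?_, by simp⟩
  dsimp only
  split_ifs
  exacts [(localSubring C α).one_mem, (localSubring C α).zero_mem]

theorem mem_localSpan_trans {α : Cbar C} {V V' : Fin r → (Fin r → RatFunc C)}
    (h : ∀ i, V i ∈ localSpan C r α V') {f : Fin r → RatFunc C} (hf : f ∈ localSpan C r α V) :
    f ∈ localSpan C r α V' := by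
  obtain ⟨c, hc, rfl⟩ := hf
  choose d hd hV using h
  refine ⟨fun j => ∑ i, c i * d i j, fun j => ?_, ?_⟩
  · exact (localSubring C α).sum_mem fun i _ => (localSubring C α).mul_mem (hc i) (hd i j)
  · simp_rw [Finset.sum_smul, mul_smul]
    rw [Finset.sum_comm]
    refine Finset.sum_congr rfl fun i _ => ?_
    rw [← Finset.smul_sum, ← hV i]

/-! ### The action of `S` -/

theorem Smap_sum_smul (c : Fin r → RatFunc C) (V : Fin r → (Fin r → RatFunc C)) :
    Smap C ℓ r (∑ i, c i • V i) = ∑ i, ratσ C (c i) • Smap C ℓ r (V i) := by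
  funext j
  simp only [Smap, Finset.sum_apply, Pi.smul_apply, smul_eq_mul, map_sum, map_mul]
  split_ifs
  · simp [Finset.sum_mul, mul_assoc]
  · simp [Finset.sum_mul, mul_assoc, mul_sub]

theorem Smap_mem_localSpan {α : Cbar C} {V : Fin r → (Fin r → RatFunc C)}
    {f : Fin r → RatFunc C} (hf : f ∈ localSpan C r (α + 1) V) :
    Smap C ℓ r f ∈ localSpan C r α (fun i => Smap C ℓ r (V i)) := by
  obtain ⟨c, hc, rfl⟩ := hf
  exact ⟨fun i => ratσ C (c i), fun i => (hc i).ratσ, Smap_sum_smul C ℓ r c V⟩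

theorem elemApply_Smap (hr : ℓ r ≠ 0) {α : Cbar C} {b : ℤ → LS C}
    (hb : b ∈ SolSet C ℓ r α) (g : Fin r → RatFunc C) (n : ℤ) :
    elemApply C r α (Smap C ℓ r g) b n = elemApply C r α g b (n + 1) := by
  obtain ⟨s, rfl⟩ := Nat.exists_eq_succ_of_ne_zero (NeZero.ne r)
  have hlast : lastIdx (s + 1) = Fin.last s := rfl
  have hrec := hb n
  have hne := evalHom_toRat_ne_zero C α n hr
  simp only [Nat.succ_eq_add_one] at *
  rw [Finset.sum_range_succ, Finset.sum_range] at hrec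
  simp only [evalAt_eq_evalHom] at hrec
  simp only [elemApply, Smap, hlast, evalAt_eq_evalHom, map_sub, sub_mul, map_mul, map_div₀,
    Finset.sum_sub_distrib]
  have h1 : ∑ x : Fin (s + 1), evalHom C α n (ratσ C (g (Fin.last s))) *
      (evalHom C α n (toRat C (ℓ x)) / evalHom C α n (toRat C (ℓ (s + 1)))) * b (n + (x : ℕ)) =
      - (evalHom C α (n + 1) (g (Fin.last s)) * b (n + (s + 1 : ℕ))) := by
    rw [← evalHom_ratσ]
    have : ∀ x : Fin (s + 1), evalHom C α n (ratσ C (g (Fin.last s))) *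
      (evalHom C α n (toRat C (ℓ x)) / evalHom C α n (toRat C (ℓ (s + 1)))) * b (n + (x : ℕ)) =
      evalHom C α n (ratσ C (g (Fin.last s))) / evalHom C α n (toRat C (ℓ (s + 1))) *
        (evalHom C α n (toRat C (ℓ x)) * b (n + (x : ℕ))) := fun x => by ring
    simp_rw [this]
    rw [← Finset.mul_sum, eq_neg_of_add_eq_zero_left hrec]
    field_simp
  rw [h1, Fin.sum_univ_succ, Fin.sum_univ_castSucc (n := s)]
  simp [evalHom_ratσ]
  congr 1
  · refine Finset.sum_congr rfl fun i _ => ?_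
    rw [add_right_comm, add_assoc]
    rfl
  · rw [add_right_comm, add_assoc]

theorem integralAt_add_one (hr : ℓ r ≠ 0) {α : Cbar C} {g : Fin r → RatFunc C}
    (h : IntegralAt C ℓ r α (Smap C ℓ r g)) : IntegralAt C ℓ r (α + 1) g := by
  unfold IntegralAt valAt at *
  rw [le_iInf₂_iff] at *
  intro b hb
  have hb' : (fun n => b (n - 1)) ∈ SolSet C ℓ r α := by
    intro n
    have := hb (n - 1)
    simp only [evalAt_add_one, sub_add_cancel] at this
    rw [← this]
    refine Finset.sum_congr rfl fun i _ => ?_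
    rw [sub_add_eq_add_sub]
  have key := h _ hb'
  rw [elemApply_Smap C ℓ r hr hb'] at key
  have h1 : elemApply C r α g (fun n => b (n - 1)) (0 + 1) = elemApply C r (α + 1) g b 0 := by
    simp only [elemApply, evalAt_add_one]
    refine Finset.sum_congr rfl fun i _ => ?_
    congr 2
    ring
  have h2 : Filter.liminf (fun n : ℕ => nuq C (b (-(n : ℤ) - 1))) Filter.atTop =
      Filter.liminf (fun n : ℕ => nuq C (b (-(n : ℤ)))) Filter.atTop := by
    rw [← Filter.liminf_nat_add (fun n : ℕ => nuq C (b (-(n : ℤ)))) 1]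
    congr 1
    funext n
    rw [Nat.cast_succ, neg_add, sub_eq_add_neg]
  rwa [h1, h2] at key

/-! ### Integrality of the standard basis below the first singularity -/

theorem lt_nuq_iff {a : LS C} {m : ℤ} :
    (((m : ℤ) : ℝ) : EReal) < nuq C a ↔ (m : WithTop ℤ) < HahnSeries.orderTop a := by
  unfold nuq
  split_ifs with h
  · simp [h]
  · rw [EReal.coe_lt_coe_iff, Int.cast_lt, ← HahnSeries.order_eq_orderTop_of_ne_zero h,
      WithTop.coe_lt_coe]

theorem lt_orderTop_ofPowerSeries_mul {a : LS C} {m : ℤ} (u : PowerSeries (Cbar C))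
    (h : (m : WithTop ℤ) < HahnSeries.orderTop a) :
    (m : WithTop ℤ) < HahnSeries.orderTop (HahnSeries.ofPowerSeries ℤ (Cbar C) u * a) := by
  have hu : (0 : WithTop ℤ) ≤ HahnSeries.orderTop (HahnSeries.ofPowerSeries ℤ (Cbar C) u) := by
    rw [← WithTop.coe_zero, HahnSeries.le_orderTop_iff_forall]
    intro j hj
    rw [WithTop.coe_lt_coe] at hj
    rw [HahnSeries.ofPowerSeries_apply]
    refine HahnSeries.embDomain_of_notMem_range ?_
    rintro ⟨k, rfl⟩
    simp at hj
    omega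
  refine h.trans_le (le_trans ?_ HahnSeries.orderTop_add_le_mul)
  calc a.orderTop = 0 + a.orderTop := (zero_add _).symm
    _ ≤ _ := by gcongr

theorem lt_orderTop_sum {ι : Type*} {s : Finset ι} {a : ι → LS C} {m : ℤ}
    (h : ∀ i ∈ s, (m : WithTop ℤ) < HahnSeries.orderTop (a i)) :
    (m : WithTop ℤ) < HahnSeries.orderTop (∑ i ∈ s, a i) := by
  classical
  induction s using Finset.induction_on with
  | empty => simp
  | insert i s hi ih =>
    rw [Finset.sum_insert hi]
    exact lt_of_lt_of_le (lt_min (h i (by simp)) (ih fun j hj => h j (by simp [hj])))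
      HahnSeries.min_orderTop_le_orderTop_add

theorem lt_orderTop_of_window {α : Cbar C} {b : ℤ → LS C} (hb : b ∈ SolSet C ℓ r α) {z m : ℤ}
    (hz : Polynomial.aeval (α + (z : Cbar C)) (ℓ r) ≠ 0)
    (h : ∀ i < r, (m : WithTop ℤ) < HahnSeries.orderTop (b (z + (i : ℕ)))) :
    (m : WithTop ℤ) < HahnSeries.orderTop (b (z + r)) := by
  have hrec := hb z
  rw [Finset.sum_range_succ] at hrec
  simp only [evalAt_eq_evalHom, evalHom_toRat] at hrec
  rw [← constantCoeff_taylorPS] at hz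
  have hinv := PowerSeries.mul_inv_cancel _ hz
  set u := taylorPS C α z (ℓ r)
  have hsol : b (z + r) = HahnSeries.ofPowerSeries ℤ (Cbar C) (-u⁻¹) *
      ∑ i ∈ Finset.range r,
        HahnSeries.ofPowerSeries ℤ (Cbar C) (taylorPS C α z (ℓ i)) * b (z + i) := by
    rw [eq_neg_of_add_eq_zero_left hrec, map_neg, neg_mul_neg, ← mul_assoc, ← map_mul,
      mul_comm u⁻¹, hinv, map_one, one_mul]
  rw [hsol]
  exact lt_orderTop_ofPowerSeries_mul C _ (lt_orderTop_sum C fun i hi =>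
    lt_orderTop_ofPowerSeries_mul C _ (h i (Finset.mem_range.mp hi)))

theorem liminf_nuq_le {α : Cbar C}
    (hα : ∀ z : ℤ, z < 0 → Polynomial.aeval (α + (z : Cbar C)) (ℓ r) ≠ 0)
    {b : ℤ → LS C} (hb : b ∈ SolSet C ℓ r α) {j : ℕ} (hj : j < r) :
    Filter.liminf (fun n : ℕ => nuq C (b (-(n : ℤ)))) Filter.atTop ≤ nuq C (b j) := by
  by_contra! hlt
  by_cases h0 : b j = 0
  · simp [nuq, h0] at hlt
  set m := (b j).order with hm
  have hmj : nuq C (b j) = (((m : ℤ) : ℝ) : EReal) := by simp [nuq, h0, hm]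
  rw [hmj] at hlt
  obtain ⟨n₀, hn₀⟩ := Filter.eventually_atTop.mp (Filter.eventually_lt_of_lt_liminf hlt)
  have key : ∀ k : ℕ, k < n₀ + r + r →
      (m : WithTop ℤ) < HahnSeries.orderTop (b (-((n₀ + r : ℕ) : ℤ) + k)) := by
    intro k
    induction k using Nat.strong_induction_on with
    | _ k ih =>
      intro hk
      by_cases hkr : k < r
      · have := hn₀ (n₀ + r - k) (by omega)
        rw [lt_nuq_iff] at this
        convert this using 3
        omega
      · have hz := lt_orderTop_of_window C ℓ r hb (z := -((n₀ + r : ℕ) : ℤ) + ((k - r : ℕ) : ℤ))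
          (m := m) (hα _ (by omega)) (fun i hi => by
            have := ih (k - r + i) (by omega) (by omega)
            convert this using 3
            omega)
        convert hz using 3
        omega
  have hfin := key (n₀ + r + j) (by omega)
  rw [show -((n₀ + r : ℕ) : ℤ) + ((n₀ + r + j : ℕ) : ℤ) = j by omega, ← lt_nuq_iff, hmj] at hfin
  exact lt_irrefl _ hfin

theorem integralAt_stdBasis {α : Cbar C}
    (hα : ∀ z : ℤ, z < 0 → Polynomial.aeval (α + (z : Cbar C)) (ℓ r) ≠ 0) (j : Fin r) :
    IntegralAt C ℓ r α (stdBasis C r j) := by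
  unfold IntegralAt valAt
  rw [le_iInf₂_iff]
  intro b hb
  have hval : elemApply C r α (stdBasis C r j) b 0 = b (j : ℕ) := by
    simp only [elemApply, stdBasis, evalAt_eq_evalHom]
    rw [Finset.sum_eq_single j]
    · simp
    · intro i _ hi
      simp [hi]
    · simp
  have hle := liminf_nuq_le C ℓ r hα hb j.isLt
  rw [hval]
  unfold esub
  split_ifs with htop
  · exact le_top
  · refine (EReal.sub_nonneg (Or.inr htop) (Or.inl ?_)).mpr hle
    unfold nuq
    split_ifs <;> simp

/-! ### The standard basis at nonsingular points -/

theorem stdBasis_mem_localSpan_Smap (hr : ℓ r ≠ 0) {α : Cbar C}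
    (hα : Polynomial.aeval α (ℓ 0) ≠ 0) (j : Fin r) :
    stdBasis C r j ∈ localSpan C r α (fun i => Smap C ℓ r (stdBasis C r i)) := by
  obtain ⟨s, rfl⟩ := Nat.exists_eq_succ_of_ne_zero (NeZero.ne r)
  simp only [Nat.succ_eq_add_one] at *
  have h0 : toRat C (ℓ 0) ≠ 0 := by
    apply RatFunc.algebraMap_ne_zero
    intro h
    simp [h] at hα
  have hr' : toRat C (ℓ (s + 1)) ≠ 0 := RatFunc.algebraMap_ne_zero hr
  have hlast : lastIdx (s + 1) = Fin.last s := rfl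
  have hcast : ∀ i : Fin s, Smap C ℓ (s + 1) (stdBasis C (s + 1) i.castSucc) =
      stdBasis C (s + 1) i.succ := by
    intro i
    funext k
    refine Fin.cases ?_ (fun k => ?_) k
    · simp [Smap, stdBasis, hlast, (Fin.castSucc_lt_last i).ne', (Fin.succ_ne_zero i).symm]
    · have : (⟨(k.succ : Fin (s + 1)).val - 1, by omega⟩ : Fin (s + 1)) = k.castSucc := by
        ext; simp
      simp only [Smap, stdBasis, hlast, (Fin.castSucc_lt_last i).ne', this]
      by_cases hki : k = i <;> simp [hki]
  refine Fin.cases ?_ (fun i => ?_) j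
  · have hinv : InLocalRing C α (1 / toRat C (ℓ 0)) := ⟨1, ℓ 0, hα, by simp⟩
    refine ⟨Fin.lastCases (-(toRat C (ℓ (s + 1)) * (1 / toRat C (ℓ 0))))
      (fun i => -(toRat C (ℓ (i + 1)) * (1 / toRat C (ℓ 0)))), ?_, ?_⟩
    · refine fun i => Fin.lastCases ?_ (fun i => ?_) i
      all_goals
        simp only [Fin.lastCases_last, Fin.lastCases_castSucc]
        exact (localSubring C α).neg_mem
          ((localSubring C α).mul_mem (inLocalRing_toRat C α _) hinv)
    · rw [Fin.sum_univ_castSucc]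
      simp only [Fin.lastCases_last, Fin.lastCases_castSucc, hcast]
      funext k
      refine Fin.cases ?_ (fun k => ?_) k
      · simp [Smap, stdBasis, hlast, (Fin.succ_ne_zero _).symm]
        field_simp
      · have : (⟨(k.succ : Fin (s + 1)).val - 1, by omega⟩ : Fin (s + 1)) = k.castSucc := by
          ext; simp
        simp only [Pi.add_apply, Finset.sum_apply, Pi.smul_apply, Smap, hlast, this]
        simp [stdBasis, (Fin.castSucc_lt_last k).ne]
        field_simp
        ring
  · rw [← hcast i]
    exact mem_localSpan_self C (s + 1) α (fun i => Smap C ℓ (s + 1) (stdBasis C (s + 1) i)) _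

/-! ### Suitable bases -/

theorem Smap_surjective_of_basis {W : Fin r → (Fin r → RatFunc C)}
    (hW : IsVSBasis C r W) (M : Fin r → Fin r → RatFunc C)
    (hM : ∀ i, W i = ∑ j, M i j • Smap C ℓ r (W j)) (f : Fin r → RatFunc C) :
    ∃ g, Smap C ℓ r g = f := by
  have hf : f ∈ Submodule.span (RatFunc C) (Set.range W) := by rw [hW.2]; trivial
  obtain ⟨c, rfl⟩ := (Submodule.mem_span_range_iff_exists_fun _).mp hf
  choose d hd using fun j => ratσ_surjective C (∑ i, c i * M i j)
  refine ⟨∑ j, d j • W j, ?_⟩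
  rw [Smap_sum_smul]
  simp_rw [hd, Finset.sum_smul, mul_smul]
  rw [Finset.sum_comm]
  refine Finset.sum_congr rfl fun i _ => ?_
  rw [← Finset.smul_sum, ← hM i]

theorem aeval_leading_ne_zero_of_lt_minR {I : ℕ} (D : SuitableData C ℓ r I) (i : Fin I) {z : ℤ}
    (hz : z < 0) : Polynomial.aeval (D.minR i + (z : Cbar C)) (ℓ r) ≠ 0 := by
  intro h
  have := (D.roots_between i z (by rw [map_mul, h, mul_zero])).1
  omega

theorem memZ_add_one_of_root {I : ℕ} (D : SuitableData C ℓ r I) {ξ : Cbar C}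
    (hξ : ∀ i, ξ ≠ D.β i) (h : Polynomial.aeval ξ (ℓ 0) = 0) : memZ C ℓ r D (ξ + 1) := by
  have hroot : Polynomial.aeval ξ (ℓ 0 * ℓ r) = 0 := by rw [map_mul, h, zero_mul]
  obtain ⟨i, m, hm⟩ := D.orbits_cover ξ hroot
  obtain ⟨u, hu⟩ := D.minR_le_maxR i
  obtain ⟨v, hv⟩ := D.maxR_le_β i
  have hξ' : ξ = D.minR i + ((u + v + m : ℤ) : Cbar C) := by
    rw [hm, hv, hu]; push_cast; ring
  rw [hξ'] at hroot
  obtain ⟨hnn, k, hk⟩ := D.roots_between i _ hroot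
  rw [← hξ'] at hk
  obtain ⟨n, hn⟩ := Int.eq_ofNat_of_zero_le hnn
  have hβ : D.β i = ξ + ((k + v : ℕ) : Cbar C) := by rw [hv, hk]; push_cast; ring
  refine ⟨i, ⟨k + v - 1, ?_⟩, ⟨n + 1, by omega, ?_⟩⟩
  · have hpos : 1 ≤ k + v := by
      by_contra hc
      have hkv : k + v = 0 := by omega
      rw [hkv] at hβ
      exact hξ i (by simpa using hβ.symm)
    rw [hβ, Nat.cast_sub hpos]
    push_cast
    ring
  · rw [hξ', hn]; push_cast; ring

theorem suitable_mem_localSpan_Smap {I : ℕ} (hr : ℓ r ≠ 0) (D : SuitableData C ℓ r I)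
    {W : Fin r → (Fin r → RatFunc C)} (hW : IsSuitableBasis C ℓ r D W)
    (hsurj : ∀ f, ∃ g, Smap C ℓ r g = f) {ξ : Cbar C} (hξ : ∀ i, ξ ≠ D.β i) (i : Fin r) :
    W i ∈ localSpan C r ξ (fun j => Smap C ℓ r (W j)) := by
  obtain ⟨-, hin, hout⟩ := hW
  have hintegral : memZ C ℓ r D (ξ + 1) → ∀ f, IntegralAt C ℓ r ξ f →
      f ∈ localSpan C r ξ (fun j => Smap C ℓ r (W j)) := by
    intro hz f hf
    obtain ⟨g, rfl⟩ := hsurj f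
    exact Smap_mem_localSpan C ℓ r
      ((hin _ hz).2.2 g (integralAt_add_one C ℓ r hr hf))
  by_cases hZ : memZ C ℓ r D ξ
  · refine hintegral ?_ _ ((hin ξ hZ).2.1 i)
    obtain ⟨t, ⟨m, hm⟩, ⟨k, hk1, hk⟩⟩ := hZ
    cases m with
    | zero => exact absurd (by simpa using hm) (hξ t)
    | succ m =>
      refine ⟨t, ⟨m, ?_⟩, ⟨k + 1, by omega, ?_⟩⟩
      · rw [← hm]; push_cast; ring
      · rw [hk]; push_cast; ring
  · have hWi : W i ∈ localSpan C r ξ (stdBasis C r) := by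
      rw [← hout ξ hZ]
      exact mem_localSpan_self C r ξ W i
    refine mem_localSpan_trans C r (fun j => ?_) hWi
    by_cases hZ1 : memZ C ℓ r D (ξ + 1)
    · refine hintegral hZ1 _ ?_
      obtain ⟨t, ⟨m, hm⟩, ⟨k, hk1, hk⟩⟩ := hZ1
      have hξt : ξ = D.minR t := by
        by_contra hne
        have hk2 : k ≠ 1 := by
          rintro rfl
          exact hne (by simpa using hk)
        refine hZ ⟨t, ⟨m + 1, ?_⟩, ⟨k - 1, by omega, ?_⟩⟩
        · rw [← hm]; push_cast; ring
        · rw [Nat.cast_sub hk1]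
          push_cast
          linear_combination hk
      subst hξt
      exact integralAt_stdBasis C ℓ r
        (fun z hz => aeval_leading_ne_zero_of_lt_minR C ℓ r D t hz) j
    · refine mem_localSpan_trans C r (fun k => ?_)
        (stdBasis_mem_localSpan_Smap C ℓ r hr (fun h => hZ1 (memZ_add_one_of_root C ℓ r D hξ h)) j)
      refine Smap_mem_localSpan C ℓ r ?_
      rw [hout _ hZ1]
      exact mem_localSpan_self C r _ _ k

theorem shiftFree_of_roots {I : ℕ} (D : SuitableData C ℓ r I) {f : Polynomial C}
    (h : ∀ ξ : Cbar C, Polynomial.aeval ξ f = 0 → ∃ i, ξ = D.β i) : ShiftFree f := by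
  intro k hk
  by_contra hcop
  rw [Polynomial.isCoprime_iff_aeval_ne_zero_of_isAlgClosed C (Cbar C)] at hcop
  push Not at hcop
  obtain ⟨ξ, h1, h2⟩ := hcop
  obtain ⟨i, hi⟩ := h ξ h1
  have h2' : Polynomial.aeval (ξ + (k : Cbar C)) f = 0 := by
    simpa [Polynomial.aeval_comp] using h2
  obtain ⟨i', hi'⟩ := h _ h2'
  by_cases hii : i' = i
  · subst hii
    rw [← hi] at hi'
    exact hk (by simpa using hi')
  · exact D.orbits_distinct i' i hii k (by rw [← hi, ← hi'])

theorem statement10 [NeZero r] (hr : 1 ≤ r) (hℓ : ℓ 0 * ℓ r ≠ 0) {I : ℕ}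
    (D : SuitableData C ℓ r I) (W : Fin r → (Fin r → RatFunc C))
    (hW : IsSuitableBasis C ℓ r D W)
    (fw : Polynomial C) (N : Matrix (Fin r) (Fin r) (Polynomial C)) (hfw : fw ≠ 0)
    (hNW : ∀ i, W i = ∑ j, (toRat C (N i j) / toRat C fw) • Smap C ℓ r (W j))
    (hgcd : ∀ d : Polynomial C, d ∣ fw → (∀ i j, d ∣ N i j) → IsUnit d) :
    ShiftFree fw ∧ (∀ ξ : Cbar C, (Polynomial.aeval ξ) fw = 0 → ∃ i, ξ = D.β i) ∧
      IsUnit (N.map (toRat C)) := by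
  have hℓr : ℓ r ≠ 0 := right_ne_zero_of_mul hℓ
  have hfw' : toRat C fw ≠ 0 := RatFunc.algebraMap_ne_zero hfw
  set WM : Matrix (Fin r) (Fin r) (RatFunc C) := Matrix.of W with hWM
  set SM : Matrix (Fin r) (Fin r) (RatFunc C) := Matrix.of (fun j => Smap C ℓ r (W j)) with hSM
  have hprod : WM = ((toRat C fw)⁻¹ • N.map (toRat C)) * SM := by
    ext i k
    have := congrFun (hNW i) k
    simp only [hWM, hSM, Matrix.of_apply, Matrix.mul_apply, Matrix.smul_apply, Matrix.map_apply,
      smul_eq_mul]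
    rw [this, Finset.sum_apply]
    refine Finset.sum_congr rfl fun j _ => ?_
    rw [Pi.smul_apply, smul_eq_mul, div_eq_inv_mul]
  have hWunit : IsUnit WM := Matrix.linearIndependent_rows_iff_isUnit.mp hW.1.1
  rw [hprod, Matrix.isUnit_iff_isUnit_det, Matrix.det_mul, IsUnit.mul_iff, Matrix.det_smul,
    IsUnit.mul_iff, ← Matrix.isUnit_iff_isUnit_det, ← Matrix.isUnit_iff_isUnit_det] at hWunit
  obtain ⟨⟨-, hN⟩, hS⟩ := hWunit
  have hSind : LinearIndependent (RatFunc C) (fun j => Smap C ℓ r (W j)) :=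
    Matrix.linearIndependent_rows_iff_isUnit.mpr hS
  have hsurj := Smap_surjective_of_basis C ℓ r hW.1 _ hNW
  have hroots : ∀ ξ : Cbar C, (Polynomial.aeval ξ) fw = 0 → ∃ i, ξ = D.β i := by
    intro ξ hξ
    by_contra! hne
    have hNξ : ∀ i j, Polynomial.aeval ξ (N i j) = 0 := by
      intro i j
      obtain ⟨c, hc, hci⟩ := suitable_mem_localSpan_Smap C ℓ r hℓr D hW hsurj hne i
      rw [hNW i] at hci
      have heq := linearIndependent_iff_injective_fintypeLinearCombination.mp hSind
        (a₁ := fun j => toRat C (N i j) / toRat C fw) (a₂ := c)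
        (by simpa [Fintype.linearCombination_apply] using hci)
      refine aeval_eq_zero_of_inLocalRing_div C hfw ?_ hξ
      rw [congrFun heq j]
      exact hc j
    exact minpoly.not_isUnit C ξ (hgcd _ (minpoly.dvd C ξ hξ) fun i j => minpoly.dvd C ξ (hNξ i j))
  exact ⟨shiftFree_of_roots C ℓ r D hroots, hroots, hN⟩

end PRec
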